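/- arXiv:1807.07507 — 3 statements merged into one kernel-verified Lean document; each statement's English description precedes it below -/
import Mathlib

section
/- Let P_ℓ ⊆ ℝ^K for ℓ = 1,…,L each be compact, convex, with nonempty interior, let K_ℓ ⊆ ℝ^{K+1} be the conic hull of {(x,1) : x ∈ P_ℓ}, let A ∈ ℝ^{K×K} be symmetric positive definite and b ∈ ℝ^K. Then the union ⋃_{ℓ=1}^L P_ℓ is contained in E(A,b) if and only if for every ℓ ∈ {1,…,L} there exist a symmetric F_ℓ ∈ ℝ^{K×K}, g_ℓ ∈ ℝ^K, and h_ℓ ∈ ℝ such that vᵀ·[[F_ℓ, g_ℓ],[g_ℓᵀ, h_ℓ−1]]·v ≤ 0 for all v ∈ K_ℓ, and the (2K+1)×(2K+1) block matrix [[F_ℓ, g_ℓ, A],[g_ℓᵀ, h_ℓ, bᵀ],[A, b, I_K]] is positive semidefinite. -/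
open Matrix

noncomputable section

/-- The ellipsoid `E(A,b) = {x : ‖Ax + b‖² ≤ 1}` (Euclidean norm). -/
def ellipsoid {K : ℕ} (A : Matrix (Fin K) (Fin K) ℝ) (b : Fin K → ℝ) :
    Set (Fin K → ℝ) :=
  {x | (A *ᵥ x + b) ⬝ᵥ (A *ᵥ x + b) ≤ 1}

/-- The conic hull of `{(x, 1) : x ∈ P}` inside `ℝ^{K+1}`, where the extra (last)
coordinate is indexed by `Unit`. -/
def liftCone {ι : Type*} (P : Set (ι → ℝ)) : Set ((ι ⊕ Unit) → ℝ) :=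
  {v | ∃ (n : ℕ) (lam : Fin n → ℝ) (xs : Fin n → (ι → ℝ)),
    (∀ i, 0 ≤ lam i) ∧ (∀ i, xs i ∈ P) ∧
    v = ∑ i, lam i • (Sum.elim (xs i) (fun _ => (1 : ℝ)))}

/-- The block matrix `[[F, g],[gᵀ, c]]`. -/
def blk2 {ι : Type*} (F : Matrix ι ι ℝ) (g : ι → ℝ) (c : ℝ) :
    Matrix (ι ⊕ Unit) (ι ⊕ Unit) ℝ :=
  Matrix.fromBlocks F (Matrix.of fun i _ => g i) (Matrix.of fun _ j => g j)
    (Matrix.of fun _ _ => c)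

/-- The block matrix `[[F, g, A],[gᵀ, h, bᵀ],[A, b, I_K]]`. -/
def blk3 {K : ℕ} (F : Matrix (Fin K) (Fin K) ℝ) (g : Fin K → ℝ) (h : ℝ)
    (A : Matrix (Fin K) (Fin K) ℝ) (b : Fin K → ℝ) :
    Matrix ((Fin K ⊕ Unit) ⊕ Fin K) ((Fin K ⊕ Unit) ⊕ Fin K) ℝ :=
  Matrix.fromBlocks (blk2 F g h)
    (Matrix.of (Sum.elim (fun i j => A i j) (fun _ j => b j)))
    (Matrix.of fun i => Sum.elim (fun j => A i j) (fun _ => b i))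
    1

/-- Lowering the corner entry of `blk2` by one subtracts the square of the last coordinate from
the quadratic form. -/
lemma dotProduct_blk2_sub_one_mulVec {ι : Type*} [Fintype ι] (F : Matrix ι ι ℝ) (g : ι → ℝ)
    (h : ℝ) (v : (ι ⊕ Unit) → ℝ) :
    v ⬝ᵥ (blk2 F g (h - 1) *ᵥ v) = v ⬝ᵥ (blk2 F g h *ᵥ v) - v (Sum.inr ()) ^ 2 := by
  simp [blk2, dotProduct, mulVec, Fintype.sum_sum_type]
  ring

/-- The block column `[A; bᵀ]`. -/
def stackRow {K : ℕ} (A : Matrix (Fin K) (Fin K) ℝ) (b : Fin K → ℝ) :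
    Matrix (Fin K ⊕ Unit) (Fin K) ℝ :=
  Matrix.of (Sum.elim (fun i j => A i j) (fun _ j => b j))

lemma stackRow_conjTranspose_mulVec {K : ℕ} {A : Matrix (Fin K) (Fin K) ℝ} (hA : A.IsHermitian)
    (b : Fin K → ℝ) (x : Fin K → ℝ) :
    (stackRow A b)ᴴ *ᵥ Sum.elim x (fun _ => 1) = A *ᵥ x + b := by
  ext i
  have hs : ∀ j, A j i = A i j := fun j => by simpa using hA.apply i j
  simp [stackRow, mulVec, dotProduct, Fintype.sum_sum_type, hs]

lemma dotProduct_mul_conjTranspose_mulVec {m n : Type*} [Fintype m] [Fintype n]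
    (B : Matrix m n ℝ) (v : m → ℝ) :
    v ⬝ᵥ ((B * Bᴴ) *ᵥ v) = (Bᴴ *ᵥ v) ⬝ᵥ (Bᴴ *ᵥ v) := by
  rw [← mulVec_mulVec, dotProduct_mulVec, conjTranspose_eq_transpose_of_trivial,
    mulVec_transpose]

/-- Schur complement criterion for `blk3`. -/
lemma blk3_posSemidef_iff {K : ℕ} (F : Matrix (Fin K) (Fin K) ℝ) (g : Fin K → ℝ) (h : ℝ)
    {A : Matrix (Fin K) (Fin K) ℝ} (hA : A.IsHermitian) (b : Fin K → ℝ) :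
    (blk3 F g h A b).PosSemidef ↔
      (blk2 F g h - stackRow A b * (stackRow A b)ᴴ).PosSemidef := by
  have h3 : blk3 F g h A b = fromBlocks (blk2 F g h) (stackRow A b) (stackRow A b)ᴴ 1 := by
    unfold blk3
    congr 1
    ext i (j | j)
    · simpa [stackRow] using (hA.apply i j).symm
    · simp [stackRow]
  let _ : Invertible (1 : Matrix (Fin K) (Fin K) ℝ) := invertibleOne
  rw [h3, PosDef.fromBlocks₂₂ _ _ PosDef.one, inv_one, Matrix.mul_one]

lemma blk2_eq_stackRow_mul_conjTranspose {K : ℕ} {A : Matrix (Fin K) (Fin K) ℝ}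
    (hA : A.IsHermitian) (b : Fin K → ℝ) :
    blk2 (A * A) (A *ᵥ b) (b ⬝ᵥ b) = stackRow A b * (stackRow A b)ᴴ := by
  have hs : ∀ i j, A j i = A i j := fun i j => by simpa using hA.apply i j
  ext (i | i) (j | j)
  · simp [blk2, stackRow, mul_apply, hs j]
  · simp [blk2, stackRow, mul_apply, mulVec, dotProduct]
  · simp [blk2, stackRow, mul_apply, mulVec, dotProduct, mul_comm]
  · simp [blk2, stackRow, mul_apply, dotProduct]

lemma elim_mem_liftCone {ι : Type*} {P : Set (ι → ℝ)} {x : ι → ℝ} (hx : x ∈ P) :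
    Sum.elim x (fun _ => (1 : ℝ)) ∈ liftCone P :=
  ⟨1, fun _ => 1, fun _ => x, by simp, by simp [hx], by simp⟩

/-- Over a convex set, every nonzero element of the cone is a multiple of a single generator. -/
lemma eq_zero_or_eq_smul_of_mem_liftCone {ι : Type*} {P : Set (ι → ℝ)} (hP : Convex ℝ P)
    {v : (ι ⊕ Unit) → ℝ} (hv : v ∈ liftCone P) :
    v = 0 ∨ ∃ (t : ℝ) (x : ι → ℝ), x ∈ P ∧ v = t • Sum.elim x (fun _ => (1 : ℝ)) := by
  obtain ⟨n, lam, xs, h0, hx, rfl⟩ := hv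
  rcases (Finset.sum_nonneg fun i _ => h0 i : 0 ≤ ∑ i, lam i).eq_or_lt with ht | ht
  · left
    have hz := (Finset.sum_eq_zero_iff_of_nonneg fun i _ => h0 i).1 ht.symm
    exact Finset.sum_eq_zero fun i hi => by rw [hz i hi, zero_smul]
  · refine Or.inr ⟨∑ i, lam i, Finset.univ.centerMass lam xs,
      hP.centerMass_mem (fun i _ => h0 i) ht (fun i _ => hx i), ?_⟩
    ext (j | j)
    · simp [Finset.centerMass, mul_inv_cancel_left₀ ht.ne']
    · simp

/-- Union of sets: `⋃ ℓ, P ℓ ⊆ E(A,b)` iff for every `ℓ` a generalized copositive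
containment certificate w.r.t. the cone `K_ℓ = cone{(x,1) : x ∈ P_ℓ}` exists. -/
theorem stmt_5 {K L : ℕ} (P : Fin L → Set (Fin K → ℝ))
    (hPc : ∀ ℓ, IsCompact (P ℓ)) (hPconv : ∀ ℓ, Convex ℝ (P ℓ))
    (hPint : ∀ ℓ, (interior (P ℓ)).Nonempty)
    (A : Matrix (Fin K) (Fin K) ℝ) (hA : A.PosDef) (b : Fin K → ℝ) :
    (⋃ ℓ, P ℓ) ⊆ ellipsoid A b ↔
      ∀ ℓ, ∃ (F : Matrix (Fin K) (Fin K) ℝ) (g : Fin K → ℝ) (h : ℝ), F.IsSymm ∧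
        (∀ v ∈ liftCone (P ℓ), v ⬝ᵥ ((blk2 F g (h - 1)) *ᵥ v) ≤ 0) ∧
        (blk3 F g h A b).PosSemidef := by
  have hH := hA.isHermitian
  rw [Set.iUnion_subset_iff]
  refine forall_congr' fun ℓ => ⟨fun hsub => ?_, ?_⟩
  · refine ⟨A * A, A *ᵥ b, b ⬝ᵥ b, ?_, fun v hv => ?_, ?_⟩
    · have hs : Aᵀ = A := by simpa [IsHermitian] using hH
      simp [IsSymm, transpose_mul, hs]
    · rw [dotProduct_blk2_sub_one_mulVec, blk2_eq_stackRow_mul_conjTranspose hH,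
        dotProduct_mul_conjTranspose_mulVec]
      obtain rfl | ⟨t, x, hx, rfl⟩ := eq_zero_or_eq_smul_of_mem_liftCone (hPconv ℓ) hv
      · simp
      · have hE : (A *ᵥ x + b) ⬝ᵥ (A *ᵥ x + b) ≤ 1 := hsub hx
        rw [mulVec_smul, stackRow_conjTranspose_mulVec hH, smul_dotProduct, dotProduct_smul]
        simp only [Pi.smul_apply, Sum.elim_inr, smul_eq_mul]
        nlinarith [mul_le_mul_of_nonneg_left hE (sq_nonneg t)]
    · rw [blk3_posSemidef_iff _ _ _ hH, blk2_eq_stackRow_mul_conjTranspose hH, sub_self]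
      exact PosSemidef.zero
  · rintro ⟨F, g, h, -, hcop, hpsd⟩ x hx
    have hle := hcop _ (elim_mem_liftCone hx)
    have hge := ((blk3_posSemidef_iff F g h hH b).1 hpsd).dotProduct_mulVec_nonneg
      (Sum.elim x fun _ => 1)
    rw [dotProduct_blk2_sub_one_mulVec] at hle
    rw [star_trivial, sub_mulVec, dotProduct_sub, dotProduct_mul_conjTranspose_mulVec,
      stackRow_conjTranspose_mulVec hH] at hge
    simp only [Sum.elim_inr] at hle
    change (A *ᵥ x + b) ⬝ᵥ (A *ᵥ x + b) ≤ 1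
    linarith
end
end

section
/- Let P = {x ∈ ℝ^K : Sx ≤ t, ‖Q_i x + q_i‖² ≤ 1 for all i ∈ [I]} with S ∈ ℝ^{J×K}, t ∈ ℝ^J, Q_i ∈ ℝ^{K×K} symmetric, q_i ∈ ℝ^K, and let A ∈ ℝ^{K×K} be symmetric positive definite and b ∈ ℝ^K. Define 𝒮 = [−S t] ∈ ℝ^{J×(K+1)}, J_i = [[Q_i², Q_i q_i],[(Q_i q_i)ᵀ, q_iᵀq_i − 1]] ∈ ℝ^{(K+1)×(K+1)} for i ∈ [I], and for α ∈ ℝ^K, κ ∈ ℝ, i ∈ [I], j ∈ [J], let M_{ij}(α,κ) = [[−(1/2)(S_{j:}αᵀQ_i + Q_i α S_{j:}ᵀ), (1/2)(t_j Q_i α − (αᵀq_i + κ)S_{j:})],[(1/2)(t_j Q_i α − (αᵀq_i + κ)S_{j:})ᵀ, (αᵀq_i + κ)t_j]], where S_{j:} ∈ ℝ^K is the transpose of the j-th row of S. Suppose there exist an entrywise nonnegative N ∈ ℝ^{J×J}, a symmetric F ∈ ℝ^{K×K}, g ∈ ℝ^K, h ∈ ℝ, scalars λ_i ≥ 0 for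 i ∈ [I], and vectors α_{ij} ∈ ℝ^K and scalars κ_{ij} ∈ ℝ for i ∈ [I], j ∈ [J], such that: (i) ‖α_{ij}‖ ≤ κ_{ij} for all i, j; (ii) [[F, g],[gᵀ, h−1]] ⪯ −𝒮ᵀN𝒮 + Σ_{i∈[I]} λ_i J_i − Σ_{i∈[I], j∈[J]} M_{ij}(α_{ij}, κ_{ij}) in the Loewner order; and (iii) the block matrix [[F, g, A],[gᵀ, h, bᵀ],[A, b, I_K]] is positive semidefinite. Then P ⊆ E(A,b). -/
open Matrix

noncomputable section

/-- `𝒮 = [−S  t]`. -/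
def calS {ι : Type*} {K : ℕ} (S : Matrix ι (Fin K) ℝ) (t : ι → ℝ) :
    Matrix ι (Fin K ⊕ Unit) ℝ :=
  Matrix.of fun j => Sum.elim (fun k => -S j k) (fun _ => t j)

/-- `J_i = [[Q_i², Q_i q_i],[(Q_i q_i)ᵀ, q_iᵀq_i − 1]]`. -/
def Jmat {K : ℕ} (Q : Matrix (Fin K) (Fin K) ℝ) (q : Fin K → ℝ) :
    Matrix (Fin K ⊕ Unit) (Fin K ⊕ Unit) ℝ :=
  blk2 (Q * Q) (Q *ᵥ q) (q ⬝ᵥ q - 1)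

/-- `M_{ij}(α,κ)` for the SOC-RLT style certificate:
`[[−(1/2)(S_{j:}αᵀQ_i + Q_i α S_{j:}ᵀ), (1/2)(t_j Q_i α − (αᵀq_i + κ)S_{j:})],
  [(1/2)(t_j Q_i α − (αᵀq_i + κ)S_{j:})ᵀ, (αᵀq_i + κ)t_j]]`. -/
def Mij {K J : ℕ} (S : Matrix (Fin J) (Fin K) ℝ) (t : Fin J → ℝ)
    (Q : Matrix (Fin K) (Fin K) ℝ) (q : Fin K → ℝ)
    (j : Fin J) (α : Fin K → ℝ) (κ : ℝ) :
    Matrix (Fin K ⊕ Unit) (Fin K ⊕ Unit) ℝ :=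
  blk2 ((-(1/2) : ℝ) • (Matrix.vecMulVec (S j) (α ᵥ* Q) + Matrix.vecMulVec (Q *ᵥ α) (S j)))
    ((1/2 : ℝ) • (t j • (Q *ᵥ α) - (α ⬝ᵥ q + κ) • (S j)))
    ((α ⬝ᵥ q + κ) * t j)

theorem blk2_quadForm {K : ℕ} (F : Matrix (Fin K) (Fin K) ℝ) (g x : Fin K → ℝ) (c : ℝ) :
    Sum.elim x (fun _ : Unit => (1 : ℝ)) ⬝ᵥ (blk2 F g c *ᵥ Sum.elim x (fun _ => 1))
      = x ⬝ᵥ (F *ᵥ x) + 2 * (g ⬝ᵥ x) + c := by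
  have h₁ : (Matrix.of fun (i : Fin K) (_ : Unit) => g i) *ᵥ (fun _ => (1 : ℝ)) = g := by
    ext i
    simp [mulVec, dotProduct]
  have h₂ : (Matrix.of fun (_ : Unit) (j : Fin K) => g j) *ᵥ x = fun _ => g ⬝ᵥ x := rfl
  have h₃ : (Matrix.of fun (_ _ : Unit) => c) *ᵥ (fun _ => (1 : ℝ)) = fun _ => c := by
    ext i
    simp [mulVec, dotProduct]
  have h₄ (a : ℝ) : (fun _ : Unit => (1 : ℝ)) ⬝ᵥ (fun _ => a) = a := by
    simp [dotProduct]
  simp only [blk2, fromBlocks_mulVec, Sum.elim_comp_inl, Sum.elim_comp_inr,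
    sumElim_dotProduct_sumElim, h₁, h₂, h₃, dotProduct_add, h₄, dotProduct_comm x g]
  ring

theorem calS_mulVec {ι : Type*} {K : ℕ} (S : Matrix ι (Fin K) ℝ) (t : ι → ℝ) (x : Fin K → ℝ) :
    calS S t *ᵥ Sum.elim x (fun _ => 1) = t - S *ᵥ x := by
  ext j
  simp [calS, mulVec, dotProduct, Fintype.sum_sum_type]
  ring

theorem Jmat_quadForm {K : ℕ} {Q : Matrix (Fin K) (Fin K) ℝ} (hQ : Q.IsSymm) (q x : Fin K → ℝ) :
    Sum.elim x (fun _ : Unit => (1 : ℝ)) ⬝ᵥ (Jmat Q q *ᵥ Sum.elim x (fun _ => 1))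
      = (Q *ᵥ x + q) ⬝ᵥ (Q *ᵥ x + q) - 1 := by
  have hs (u v : Fin K → ℝ) : u ⬝ᵥ (Q *ᵥ v) = (Q *ᵥ u) ⬝ᵥ v := by
    rw [dotProduct_mulVec, ← mulVec_transpose, hQ.eq]
  rw [Jmat, blk2_quadForm, ← mulVec_mulVec, hs x, ← hs q x]
  simp only [add_dotProduct, dotProduct_add, dotProduct_comm (Q *ᵥ x) q]
  ring

theorem Mij_quadForm {K J : ℕ} (S : Matrix (Fin J) (Fin K) ℝ) (t : Fin J → ℝ)
    {Q : Matrix (Fin K) (Fin K) ℝ} (hQ : Q.IsSymm) (q : Fin K → ℝ)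
    (j : Fin J) (α : Fin K → ℝ) (κ : ℝ) (x : Fin K → ℝ) :
    Sum.elim x (fun _ : Unit => (1 : ℝ)) ⬝ᵥ (Mij S t Q q j α κ *ᵥ Sum.elim x (fun _ => 1))
      = (α ⬝ᵥ (Q *ᵥ x + q) + κ) * (t j - S j ⬝ᵥ x) := by
  have hs : (Q *ᵥ α) ⬝ᵥ x = α ⬝ᵥ (Q *ᵥ x) := by
    rw [dotProduct_mulVec, ← mulVec_transpose, hQ.eq]
  rw [Mij, blk2_quadForm]
  simp only [smul_mulVec, add_mulVec, vecMulVec_mulVec, dotProduct_smul, smul_dotProduct,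
    dotProduct_add, sub_dotProduct, ← dotProduct_mulVec, hs, dotProduct_comm x (S j),
    dotProduct_comm x (Q *ᵥ α), op_smul_eq_smul, smul_eq_mul]
  ring

theorem blk3_quadForm {K : ℕ} (F : Matrix (Fin K) (Fin K) ℝ) (g : Fin K → ℝ) (h : ℝ)
    {A : Matrix (Fin K) (Fin K) ℝ} (hA : A.IsSymm) (b x y : Fin K → ℝ) :
    Sum.elim (Sum.elim x (fun _ : Unit => (1 : ℝ))) y ⬝ᵥ
        (blk3 F g h A b *ᵥ Sum.elim (Sum.elim x (fun _ => 1)) y)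
      = x ⬝ᵥ (F *ᵥ x) + 2 * (g ⬝ᵥ x) + h + 2 * (y ⬝ᵥ (A *ᵥ x + b)) + y ⬝ᵥ y := by
  have h₁ : (Matrix.of (Sum.elim (fun i j => A i j) (fun (_ : Unit) j => b j))) *ᵥ y
      = Sum.elim (A *ᵥ y) (fun _ => y ⬝ᵥ b) := by
    rw [dotProduct_comm y]
    ext i
    cases i <;> rfl
  have h₂ : (Matrix.of fun i => Sum.elim (fun j => A i j) (fun _ : Unit => b i)) *ᵥ
      Sum.elim x (fun _ => 1) = A *ᵥ x + b := by
    ext i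
    simp [mulVec, dotProduct, Fintype.sum_sum_type]
  have h₃ : (fun _ : Unit => (1 : ℝ)) ⬝ᵥ (fun _ => y ⬝ᵥ b) = y ⬝ᵥ b := by
    simp [dotProduct]
  have hs : x ⬝ᵥ (A *ᵥ y) = y ⬝ᵥ (A *ᵥ x) := by
    rw [dotProduct_mulVec, ← mulVec_transpose, hA.eq, dotProduct_comm]
  simp only [blk3, fromBlocks_mulVec, Sum.elim_comp_inl, Sum.elim_comp_inr,
    sumElim_dotProduct_sumElim, h₁, h₂, dotProduct_add, blk2_quadForm, h₃, hs, one_mulVec]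
  ring

theorem dotProduct_add_nonneg_of_sqrt_le {ι : Type*} [Fintype ι] {u v : ι → ℝ} {κ : ℝ}
    (hu : Real.sqrt (u ⬝ᵥ u) ≤ κ) (hv : v ⬝ᵥ v ≤ 1) : 0 ≤ u ⬝ᵥ v + κ := by
  have hκ : 0 ≤ κ := (Real.sqrt_nonneg _).trans hu
  have hcs : (u ⬝ᵥ v) ^ 2 ≤ (u ⬝ᵥ u) * (v ⬝ᵥ v) := by
    simpa [dotProduct, sq] using Finset.sum_mul_sq_le_sq_mul_sq Finset.univ u v
  have huu : u ⬝ᵥ u ≤ κ ^ 2 := (Real.sqrt_le_left hκ).1 hu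
  have hle : (u ⬝ᵥ v) ^ 2 ≤ κ ^ 2 := by
    have hu₀ : 0 ≤ u ⬝ᵥ u := Finset.sum_nonneg fun i _ => mul_self_nonneg (u i)
    nlinarith
  linarith [(abs_le_of_sq_le_sq' hle hκ).1]

/-- Sufficient SDP conditions for a set defined by affine and quadratic inequalities
`P = {x : Sx ≤ t, ‖Q_i x + q_i‖² ≤ 1 ∀i}` to be contained in the ellipsoid `E(A,b)`. -/
theorem stmt_11 {K J I : ℕ} (S : Matrix (Fin J) (Fin K) ℝ) (t : Fin J → ℝ)
    (Q : Fin I → Matrix (Fin K) (Fin K) ℝ) (hQ : ∀ i, (Q i).IsSymm)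
    (q : Fin I → Fin K → ℝ)
    (A : Matrix (Fin K) (Fin K) ℝ) (hA : A.PosDef) (b : Fin K → ℝ)
    (N : Matrix (Fin J) (Fin J) ℝ) (hN : ∀ i j, 0 ≤ N i j)
    (F : Matrix (Fin K) (Fin K) ℝ) (hF : F.IsSymm) (g : Fin K → ℝ) (h : ℝ)
    (lam : Fin I → ℝ) (hlam : ∀ i, 0 ≤ lam i)
    (α : Fin I → Fin J → Fin K → ℝ) (κ : Fin I → Fin J → ℝ)
    (h1 : ∀ i j, Real.sqrt (α i j ⬝ᵥ α i j) ≤ κ i j)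
    (h2 : (-((calS S t)ᵀ * N * calS S t)
        + ∑ i, lam i • Jmat (Q i) (q i)
        - ∑ i, ∑ j, Mij S t (Q i) (q i) j (α i j) (κ i j)
        - blk2 F g (h - 1)).PosSemidef)
    (h3 : (blk3 F g h A b).PosSemidef) :
    {x : Fin K → ℝ | S *ᵥ x ≤ t ∧ ∀ i, (Q i *ᵥ x + q i) ⬝ᵥ (Q i *ᵥ x + q i) ≤ 1}
      ⊆ ellipsoid A b := by
  rintro x ⟨hSx, hQx⟩
  have hAs : A.IsSymm := by simpa [IsSymm, IsHermitian] using hA.isHermitian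
  have h2' := h2.dotProduct_mulVec_nonneg (Sum.elim x fun _ => 1)
  have h3' := h3.dotProduct_mulVec_nonneg (Sum.elim (Sum.elim x fun _ => 1) (-(A *ᵥ x + b)))
  rw [star_trivial, blk3_quadForm F g h hAs] at h3'
  have hslack (j : Fin J) : 0 ≤ t j - S j ⬝ᵥ x := sub_nonneg.2 (hSx j)
  have hNx : 0 ≤ (t - S *ᵥ x) ⬝ᵥ (N *ᵥ (t - S *ᵥ x)) :=
    dotProduct_nonneg_of_nonneg hslack fun i => dotProduct_nonneg_of_nonneg (hN i) hslack
  have hJx : ∑ i, lam i * ((Q i *ᵥ x + q i) ⬝ᵥ (Q i *ᵥ x + q i) - 1) ≤ 0 :=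
    Finset.sum_nonpos fun i _ => mul_nonpos_of_nonneg_of_nonpos (hlam i) (sub_nonpos.2 (hQx i))
  have hMx : 0 ≤ ∑ i, ∑ j, (α i j ⬝ᵥ (Q i *ᵥ x + q i) + κ i j) * (t j - S j ⬝ᵥ x) :=
    Finset.sum_nonneg fun i _ => Finset.sum_nonneg fun j _ =>
      mul_nonneg (dotProduct_add_nonneg_of_sqrt_le (h1 i j) (hQx i)) (hslack j)
  have hcalS : Sum.elim x (fun _ : Unit => (1 : ℝ)) ⬝ᵥ
      (((calS S t)ᵀ * N * calS S t) *ᵥ Sum.elim x fun _ => 1)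
      = (t - S *ᵥ x) ⬝ᵥ (N *ᵥ (t - S *ᵥ x)) := by
    rw [← mulVec_mulVec, ← mulVec_mulVec, calS_mulVec, dotProduct_mulVec, vecMul_transpose,
      calS_mulVec]
  simp only [star_trivial, sub_mulVec, add_mulVec, neg_mulVec, sum_mulVec, smul_mulVec,
    dotProduct_sub, dotProduct_add, dotProduct_neg, dotProduct_sum, dotProduct_smul, smul_eq_mul,
    hcalS, Jmat_quadForm (hQ _), Mij_quadForm S t (hQ _), blk2_quadForm] at h2'
  simp only [dotProduct_add] at hJx hMx
  rw [neg_dotProduct, neg_dotProduct_neg] at h3'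
  change (A *ᵥ x + b) ⬝ᵥ (A *ᵥ x + b) ≤ 1
  linarith
end
end

section
/- Let P = {x ∈ ℝ^K : Sx ≤ t, ‖Q_i x + q_i‖² ≤ 1 for all i ∈ [I]} with S ∈ ℝ^{J×K}, t ∈ ℝ^J, Q_i ∈ ℝ^{K×K} symmetric, q_i ∈ ℝ^K, and let A ∈ ℝ^{K×K} be symmetric positive definite and b ∈ ℝ^K. Suppose there exist an entrywise nonnegative vector μ ∈ ℝ^J and scalars λ_i ≥ 0 for i ∈ [I] such that the (2K+1)×(2K+1) block matrix [[0, (1/2)Sᵀμ, A],[(1/2)(Sᵀμ)ᵀ, 1 − μᵀt, bᵀ],[A, b, I_K]] + Σ_{i∈[I]} λ_i·[[Q_i², Q_i q_i, 0],[(Q_i q_i)ᵀ, q_iᵀq_i − 1, 0],[0, 0, 0]] is positive semidefinite. Then P ⊆ E(A,b). -/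
open Matrix

noncomputable section

theorem blk2_mulVec {ι : Type*} [Fintype ι] (F : Matrix ι ι ℝ) (g : ι → ℝ) (c : ℝ)
    (x : ι → ℝ) :
    blk2 F g c *ᵥ Sum.elim x 1 = Sum.elim (F *ᵥ x + g) (fun _ => g ⬝ᵥ x + c) := by
  ext (i | i) <;> simp [blk2, mulVec, dotProduct]

/-- The quadratic form of `blk2 F g c` at `(x, 1)`. -/
theorem dotProduct_blk2_mulVec {ι : Type*} [Fintype ι] (F : Matrix ι ι ℝ) (g : ι → ℝ) (c : ℝ)
    (x : ι → ℝ) :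
    Sum.elim x 1 ⬝ᵥ (blk2 F g c *ᵥ Sum.elim x 1) = x ⬝ᵥ (F *ᵥ x) + 2 * (g ⬝ᵥ x) + c := by
  rw [blk2_mulVec, sumElim_dotProduct_sumElim, dotProduct_add, dotProduct_comm x g]
  simp only [dotProduct, Finset.univ_unique, Finset.sum_singleton, Pi.one_apply, one_mul]
  ring

/-- The quadratic form of a block matrix supported on its upper left block. -/
theorem dotProduct_fromBlocks_zero_mulVec {ι κ : Type*} [Fintype ι] [Fintype κ]
    (M : Matrix ι ι ℝ) (u : ι → ℝ) (y : κ → ℝ) :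
    Sum.elim u y ⬝ᵥ (fromBlocks M 0 0 0 *ᵥ Sum.elim u y) = u ⬝ᵥ (M *ᵥ u) := by
  simp [fromBlocks_mulVec, sumElim_dotProduct_sumElim]

/-- The quadratic form of `blk3 F g h A b` at `(x, 1, y)`, for symmetric `A`. -/
theorem dotProduct_blk3_mulVec {K : ℕ} (F : Matrix (Fin K) (Fin K) ℝ) (g : Fin K → ℝ) (h : ℝ)
    {A : Matrix (Fin K) (Fin K) ℝ} (hA : A.IsSymm) (b x y : Fin K → ℝ) :
    Sum.elim (Sum.elim x 1) y ⬝ᵥ (blk3 F g h A b *ᵥ Sum.elim (Sum.elim x 1) y) =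
      x ⬝ᵥ (F *ᵥ x) + 2 * (g ⬝ᵥ x) + h + 2 * (y ⬝ᵥ (A *ᵥ x + b)) + y ⬝ᵥ y := by
  have upper : (of (Sum.elim (fun i j => A i j) (fun _ : Unit => fun j => b j)) :
      Matrix (Fin K ⊕ Unit) (Fin K) ℝ) *ᵥ y = Sum.elim (A *ᵥ y) (fun _ => b ⬝ᵥ y) := by
    ext (i | i) <;> simp [mulVec, dotProduct]
  have lower : (of (fun i => Sum.elim (fun j => A i j) (fun _ : Unit => b i)) :
      Matrix (Fin K) (Fin K ⊕ Unit) ℝ) *ᵥ Sum.elim x 1 = A *ᵥ x + b := by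
    ext i
    simp [mulVec, dotProduct]
  have symm : x ⬝ᵥ (A *ᵥ y) = y ⬝ᵥ (A *ᵥ x) := by
    rw [dotProduct_mulVec, ← mulVec_transpose, hA.eq, dotProduct_comm]
  have last : (1 : Unit → ℝ) ⬝ᵥ (fun _ => b ⬝ᵥ y) = y ⬝ᵥ b := by
    simp [dotProduct_comm y b]
  rw [blk3, fromBlocks_mulVec]
  simp only [Sum.elim_comp_inl, Sum.elim_comp_inr, sumElim_dotProduct_sumElim, dotProduct_add,
    dotProduct_blk2_mulVec, upper, lower, symm, last, one_mulVec]
  ring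

/-- Expansion of `‖Qx + q‖²` for symmetric `Q`. -/
theorem dotProduct_self_mulVec_add {ι : Type*} [Fintype ι] {Q : Matrix ι ι ℝ} (hQ : Q.IsSymm)
    (q x : ι → ℝ) :
    (Q *ᵥ x + q) ⬝ᵥ (Q *ᵥ x + q) =
      x ⬝ᵥ ((Q * Q) *ᵥ x) + 2 * ((Q *ᵥ q) ⬝ᵥ x) + q ⬝ᵥ q := by
  have symm (u v : ι → ℝ) : u ⬝ᵥ (Q *ᵥ v) = (Q *ᵥ u) ⬝ᵥ v := by
    rw [dotProduct_mulVec, ← mulVec_transpose, hQ.eq]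
  rw [← mulVec_mulVec, symm x, ← symm q x, add_dotProduct, dotProduct_add, dotProduct_add,
    dotProduct_comm (Q *ᵥ x) q]
  ring

/-- 𝒮-procedure based sufficient conditions for a set defined by affine and quadratic
inequalities `P = {x : Sx ≤ t, ‖Q_i x + q_i‖² ≤ 1 ∀i}` to be contained in the
ellipsoid `E(A,b)`. -/
theorem stmt_12 {K J I : ℕ} (S : Matrix (Fin J) (Fin K) ℝ) (t : Fin J → ℝ)
    (Q : Fin I → Matrix (Fin K) (Fin K) ℝ) (hQ : ∀ i, (Q i).IsSymm)
    (q : Fin I → Fin K → ℝ)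
    (A : Matrix (Fin K) (Fin K) ℝ) (hA : A.PosDef) (b : Fin K → ℝ)
    (μ : Fin J → ℝ) (hμ : ∀ j, 0 ≤ μ j)
    (lam : Fin I → ℝ) (hlam : ∀ i, 0 ≤ lam i)
    (hpsd : (blk3 0 ((1/2 : ℝ) • (Sᵀ *ᵥ μ)) (1 - μ ⬝ᵥ t) A b +
      ∑ i, lam i •
        Matrix.fromBlocks (blk2 (Q i * Q i) (Q i *ᵥ q i) (q i ⬝ᵥ q i - 1)) 0 0 0).PosSemidef) :
    {x : Fin K → ℝ | S *ᵥ x ≤ t ∧ ∀ i, (Q i *ᵥ x + q i) ⬝ᵥ (Q i *ᵥ x + q i) ≤ 1}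
      ⊆ ellipsoid A b := by
  rintro x ⟨hS, hq⟩
  have hsymm : A.IsSymm := by simpa [IsHermitian, IsSymm] using hA.isHermitian
  have form := hpsd.dotProduct_mulVec_nonneg (Sum.elim (Sum.elim x 1) (-(A *ᵥ x + b)))
  simp only [star_trivial, add_mulVec, sum_mulVec, smul_mulVec, dotProduct_add, dotProduct_sum,
    dotProduct_smul, dotProduct_blk3_mulVec _ _ _ hsymm, dotProduct_fromBlocks_zero_mulVec,
    dotProduct_blk2_mulVec] at form
  have affine : (Sᵀ *ᵥ μ) ⬝ᵥ x ≤ μ ⬝ᵥ t := by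
    rw [mulVec_transpose, ← dotProduct_mulVec]
    exact dotProduct_le_dotProduct_of_nonneg_left hS hμ
  have quadratic : ∑ i, lam i • (x ⬝ᵥ ((Q i * Q i) *ᵥ x) + 2 * ((Q i *ᵥ q i) ⬝ᵥ x) +
      (q i ⬝ᵥ q i - 1)) ≤ 0 := by
    refine Finset.sum_nonpos fun i _ => mul_nonpos_of_nonneg_of_nonpos (hlam i) ?_
    linarith [hq i, dotProduct_self_mulVec_add (hQ i) (q i) x]
  change (A *ᵥ x + b) ⬝ᵥ (A *ᵥ x + b) ≤ 1
  simp only [neg_dotProduct, dotProduct_neg, neg_neg, smul_dotProduct,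
    zero_mulVec, dotProduct_zero, smul_eq_mul] at form quadratic
  linarith [dotProduct_add (A *ᵥ x + b) (A *ᵥ x) b]
end
end
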